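/- Let F be a set of density matrices on ℂ^d, and suppose the set of free channels, regarded as a subset of the real vector space of linear maps on d×d complex matrices, is convex and compact. Then for every density matrix ρ on ℂ^d, the free encoding capacity C_F(ρ) equals the supremum of the Holevo quantity of {(p_x, N_x(ρ))} taken only over finite ensembles {(p_x, N_x)} in which every N_x is an extreme point of the set of free channels. -/

import Mathlib

open scoped BigOperators ComplexOrder Matrix

namespace FECpaper

/-- Square complex matrices of size `d`, the ambient space for states on `ℂ^d`. -/
abbrev Mat (d : ℕ) := Matrix (Fin d) (Fin d) ℂ

/-- A density matrix: positive semidefinite with unit trace. -/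
def IsDensityMatrix {d : ℕ} (ρ : Mat d) : Prop := ρ.PosSemidef ∧ ρ.trace = 1

/-- Von Neumann entropy (base 2), via eigenvalues; junk value `0` for non-Hermitian input.
Note `Real.logb 2 0 = 0`, so the convention `0 · log₂ 0 = 0` holds automatically. -/
noncomputable def entropy {d : ℕ} (ρ : Mat d) : ℝ :=
  if h : ρ.IsHermitian then -∑ i, h.eigenvalues i * Real.logb 2 (h.eigenvalues i) else 0

/-- A quantum channel: a map admitting a Kraus representation with `∑ k, (L k)ᴴ * L k = 1`. -/
def IsChannel {d : ℕ} (N : Mat d → Mat d) : Prop :=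
  ∃ (n : ℕ) (L : Fin n → Mat d),
    (∑ k, (L k)ᴴ * L k) = 1 ∧ ∀ A, N A = ∑ k, L k * A * (L k)ᴴ

/-- A free channel for the set `F` of free states: a channel mapping `F` into `F`. -/
def IsFreeChannel {d : ℕ} (F : Set (Mat d)) (N : Mat d → Mat d) : Prop :=
  IsChannel N ∧ ∀ σ ∈ F, N σ ∈ F

/-- A (finitely supported) probability distribution. -/
def IsProb {ι : Type*} [Fintype ι] (p : ι → ℝ) : Prop :=
  (∀ x, 0 ≤ p x) ∧ ∑ x, p x = 1

/-- Holevo quantity of a finite ensemble of states: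
`χ = S(∑ₓ pₓ ρₓ) − ∑ₓ pₓ S(ρₓ)`. -/
noncomputable def holevo {d : ℕ} {ι : Type*} [Fintype ι] (p : ι → ℝ) (ρs : ι → Mat d) : ℝ :=
  entropy (∑ x, p x • ρs x) - ∑ x, p x * entropy (ρs x)

/-- Free encoding capacity of a state `ρ` for the resource theory with free states `F`:
the supremum of Holevo quantities of ensembles obtained from `ρ` by free channels. -/
noncomputable def FEC {d : ℕ} (F : Set (Mat d)) (ρ : Mat d) : ℝ :=
  sSup {c : ℝ | ∃ (n : ℕ) (p : Fin n → ℝ) (N : Fin n → (Mat d → Mat d)),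
    IsProb p ∧ (∀ x, IsFreeChannel F (N x)) ∧ c = holevo p (fun x => N x ρ)}

/-- A stochastically free operation: a Kraus family with `∑ k, (L k)ᴴ * L k = 1` each of
whose members maps every free state to a nonnegative scalar multiple of a free state. -/
def IsStochFree {d : ℕ} (F : Set (Mat d)) {n : ℕ} (L : Fin n → Mat d) : Prop :=
  (∑ k, (L k)ᴴ * L k) = 1 ∧
  ∀ k, ∀ σ ∈ F, ∃ (c : ℝ) (τ : Mat d), 0 ≤ c ∧ τ ∈ F ∧ L k * σ * (L k)ᴴ = c • τ


section Minkowski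

variable {E : Type*} [AddCommGroup E] [Module ℝ E]

/-- The subspace of directions in which `K` extends two-sidedly around `x`. -/
def dirSub {K : Set E} (hc : Convex ℝ K) {x : E} (hx : x ∈ K) : Submodule ℝ E where
  carrier := {v | ∃ ε : ℝ, 0 < ε ∧ x + ε • v ∈ K ∧ x - ε • v ∈ K}
  zero_mem' := ⟨1, one_pos, by simpa using hx, by simpa using hx⟩
  add_mem' := by
    rintro v w ⟨ε, hε, h1, h2⟩ ⟨δ, hδ, h3, h4⟩
    have hs : δ / (ε + δ) + ε / (ε + δ) = 1 := by field_simp; ring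
    refine ⟨ε * δ / (ε + δ), by positivity, ?_, ?_⟩
    · convert hc h1 h3 (a := δ / (ε + δ)) (b := ε / (ε + δ)) (by positivity) (by positivity) hs
        using 1
      match_scalars <;> field_simp
      ring
    · convert hc h2 h4 (a := δ / (ε + δ)) (b := ε / (ε + δ)) (by positivity) (by positivity) hs
        using 1
      match_scalars <;> field_simp
      ring
  smul_mem' := by
    rintro c v ⟨ε, hε, h1, h2⟩
    rcases lt_trichotomy c 0 with h | h | h
    · refine ⟨ε / (-c), div_pos hε (by linarith), ?_, ?_⟩
      · convert h2 using 1
        match_scalars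
        · field_simp
        · have : c ≠ 0 := h.ne
          field_simp
      · convert h1 using 1
        match_scalars
        · field_simp
        · have : c ≠ 0 := h.ne
          field_simp
    · exact ⟨1, one_pos, by simpa [h] using hx, by simpa [h] using hx⟩
    · refine ⟨ε / c, div_pos hε h, ?_, ?_⟩
      · convert h1 using 1
        match_scalars <;> field_simp
      · convert h2 using 1
        match_scalars <;> field_simp

theorem mem_dirSub {K : Set E} (hc : Convex ℝ K) {x : E} (hx : x ∈ K) (v : E) :
    v ∈ dirSub hc hx ↔ ∃ ε : ℝ, 0 < ε ∧ x + ε • v ∈ K ∧ x - ε • v ∈ K := Iff.rfl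

variable [TopologicalSpace E] [IsTopologicalAddGroup E] [ContinuousSMul ℝ E] [T2Space E]
  [FiniteDimensional ℝ E]

theorem exit_point {K : Set E} (hc : Convex ℝ K) (hK : IsCompact K) {x : E} (hx : x ∈ K)
    {v : E} (hv : v ∈ dirSub hc hx) (hv0 : v ≠ 0) :
    ∃ t : ℝ, 0 < t ∧ ∃ hy : x + t • v ∈ K, dirSub hc hy < dirSub hc hx := by
  obtain ⟨ε, hε, h1, h2⟩ := (mem_dirSub hc hx v).1 hv
  have hemb : Topology.IsClosedEmbedding (fun t : ℝ => x + t • v) :=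
    (Homeomorph.addLeft x).isClosedEmbedding.comp (isClosedEmbedding_smul_left hv0)
  have hT := hemb.isCompact_preimage hK
  obtain ⟨t, htK, htmax⟩ := hT.exists_isMaxOn ⟨ε, h1⟩ continuous_id.continuousOn
  have hmax : ∀ s : ℝ, x + s • v ∈ K → s ≤ t := fun s hs => htmax hs
  have ht : 0 < t := lt_of_lt_of_le hε (hmax ε h1)
  refine ⟨t, ht, htK, lt_of_le_of_ne ?_ ?_⟩
  · rintro w ⟨δ, hδ, h3, h4⟩
    have hs : ε / (ε + t) + t / (ε + t) = 1 := by field_simp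
    refine ⟨ε / (ε + t) * δ, by positivity, ?_, ?_⟩
    · convert hc h3 h2 (a := ε / (ε + t)) (b := t / (ε + t)) (by positivity) (by positivity) hs
        using 1
      match_scalars <;> field_simp <;> ring
    · convert hc h4 h2 (a := ε / (ε + t)) (b := t / (ε + t)) (by positivity) (by positivity) hs
        using 1
      match_scalars <;> field_simp <;> ring
  · intro he
    rw [← he] at hv
    obtain ⟨δ, hδ, h3, -⟩ := hv
    have := hmax (t + δ) (by convert h3 using 1; rw [add_smul, add_assoc])
    linarith

theorem minkowski_hull {K : Set E} (hc : Convex ℝ K) (hK : IsCompact K) :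
    ∀ (n : ℕ) (x : E) (hx : x ∈ K), Module.finrank ℝ (dirSub hc hx) = n →
    x ∈ convexHull ℝ (Set.extremePoints ℝ K) := by
  intro n
  induction n using Nat.strong_induction_on with
  | _ n ih =>
  intro x hx hn
  by_cases hv : ∃ v ∈ dirSub hc hx, v ≠ 0
  · obtain ⟨v, hv, hv0⟩ := hv
    obtain ⟨t, ht, hy, hlt⟩ := exit_point hc hK hx hv hv0
    obtain ⟨s, hs, hz, hlt'⟩ := exit_point hc hK hx (neg_mem hv) (neg_ne_zero.2 hv0)
    have hy' := ih _ (hn ▸ Submodule.finrank_lt_finrank_of_lt hlt) _ hy rfl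
    have hz' := ih _ (hn ▸ Submodule.finrank_lt_finrank_of_lt hlt') _ hz rfl
    have hsum : s / (s + t) + t / (s + t) = 1 := by field_simp
    convert convex_convexHull ℝ _ hy' hz' (a := s / (s + t)) (b := t / (s + t)) (by positivity)
      (by positivity) hsum using 1
    match_scalars <;> field_simp <;> ring
  · push Not at hv
    apply subset_convexHull
    refine ⟨hx, ?_⟩
    rintro x1 h1 x2 h2 ⟨a, b, ha, hb, hab, rfl⟩
    have hb' : b = 1 - a := by linarith
    have := hv (x1 - x2) ⟨a * b, by positivity, ?_, ?_⟩
    · rw [sub_eq_zero] at this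
      rw [this, ← add_smul, hab, one_smul]
    · convert hc hx h1 (a := b) (b := a) hb.le ha.le (by linarith) using 1
      subst hb'
      match_scalars <;> ring
    · convert hc hx h2 (a := a) (b := b) ha.le hb.le (by linarith) using 1
      subst hb'
      match_scalars <;> ring

end Minkowski


theorem entropy_eq {d : ℕ} {A : Mat d} (h : A.IsHermitian) :
    entropy A = (∑ i, Real.negMulLog (h.eigenvalues i)) / Real.log 2 := by
  rw [entropy, dif_pos h, Finset.sum_div, ← Finset.sum_neg_distrib]
  refine Finset.sum_congr rfl fun i _ => ?_
  simp only [Real.negMulLog, Real.logb]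
  ring

theorem log_two_pos' : 0 < Real.log 2 := Real.log_pos (by norm_num)

/-- Diagonal entries of a unitary conjugate in terms of eigenvalues. -/
theorem diag_conj {d : ℕ} {A : Mat d} (h : A.IsHermitian) (W : Mat d) (i : Fin d) :
    ((Wᴴ * A * W) i i).re =
      ∑ k, Complex.normSq (((h.eigenvectorUnitary : Mat d)ᴴ * W) k i) * h.eigenvalues k := by
  have hs : A = (h.eigenvectorUnitary : Mat d) * Matrix.diagonal (fun k => (h.eigenvalues k : ℂ)) *
      (h.eigenvectorUnitary : Mat d)ᴴ := by
    have := h.spectral_theorem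
    rw [Unitary.conjStarAlgAut_apply] at this
    exact this
  set U : Mat d := (h.eigenvectorUnitary : Mat d) with hU
  have h2 : Wᴴ * A * W = (Uᴴ * W)ᴴ * (Matrix.diagonal (fun k => (h.eigenvalues k : ℂ)) *
      (Uᴴ * W)) := by
    conv_lhs => rw [hs]
    simp only [Matrix.conjTranspose_mul, Matrix.conjTranspose_conjTranspose, Matrix.mul_assoc]
  rw [h2, Matrix.mul_apply, Complex.re_sum]
  refine Finset.sum_congr rfl fun k _ => ?_
  rw [Matrix.diagonal_mul, Matrix.conjTranspose_apply]
  simp [Complex.normSq_apply]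
  ring

theorem sum_normSq_col {d : ℕ} {V : Mat d} (h : Vᴴ * V = 1) (i : Fin d) :
    ∑ k, Complex.normSq (V k i) = 1 := by
  have := congrFun (congrFun h i) i
  rw [Matrix.mul_apply, Matrix.one_apply_eq] at this
  have h2 := congrArg Complex.re this
  rw [Complex.re_sum] at h2
  rw [Complex.one_re] at h2
  rw [← h2]
  refine Finset.sum_congr rfl fun k _ => ?_
  simp [Complex.normSq_apply]

theorem sum_normSq_row {d : ℕ} {V : Mat d} (h : V * Vᴴ = 1) (k : Fin d) :
    ∑ i, Complex.normSq (V k i) = 1 := by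
  have := sum_normSq_col (V := Vᴴ) (by simpa using h) k
  simpa using this

theorem peierls {d : ℕ} {A : Mat d} (hA : A.PosSemidef) {W : Mat d} (hW : Wᴴ * W = 1) :
    ∑ k, Real.negMulLog (hA.1.eigenvalues k) ≤
      ∑ i, Real.negMulLog (((Wᴴ * A * W) i i).re) := by
  set U : Mat d := (hA.1.eigenvectorUnitary : Mat d) with hU
  have hUU : Uᴴ * U = 1 := Unitary.coe_star_mul_self hA.1.eigenvectorUnitary
  have hUU' : U * Uᴴ = 1 := mul_eq_one_comm.1 hUU
  have hV : (Uᴴ * W)ᴴ * (Uᴴ * W) = 1 := by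
    rw [Matrix.conjTranspose_mul, Matrix.conjTranspose_conjTranspose, Matrix.mul_assoc,
      ← Matrix.mul_assoc U, hUU', Matrix.one_mul, hW]
  have hV' := mul_eq_one_comm.1 hV
  calc ∑ k, Real.negMulLog (hA.1.eigenvalues k)
      = ∑ k, (∑ i, Complex.normSq ((Uᴴ * W) k i)) * Real.negMulLog (hA.1.eigenvalues k) := by
        simp_rw [sum_normSq_row hV', one_mul]
    _ = ∑ i, ∑ k, Complex.normSq ((Uᴴ * W) k i) * Real.negMulLog (hA.1.eigenvalues k) := by
        simp_rw [Finset.sum_mul]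
        exact Finset.sum_comm
    _ ≤ _ := by
        refine Finset.sum_le_sum fun i _ => ?_
        rw [diag_conj hA.1 W i]
        have := Real.concaveOn_negMulLog.le_map_sum (t := Finset.univ)
          (w := fun k => Complex.normSq ((Uᴴ * W) k i)) (p := hA.1.eigenvalues)
          (fun _ _ => Complex.normSq_nonneg _) (sum_normSq_col hV i)
          (fun k _ => hA.eigenvalues_nonneg k)
        simpa only [smul_eq_mul] using this

theorem diag_self {d : ℕ} {A : Mat d} (h : A.IsHermitian) (i : Fin d) :
    (((h.eigenvectorUnitary : Mat d)ᴴ * A * (h.eigenvectorUnitary : Mat d)) i i).re =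
      h.eigenvalues i := by
  have h1 : (h.eigenvectorUnitary : Mat d)ᴴ * (h.eigenvectorUnitary : Mat d) = 1 :=
    Unitary.coe_star_mul_self h.eigenvectorUnitary
  rw [diag_conj h, h1, Finset.sum_eq_single i]
  · simp
  · intro k _ hk
    simp [Matrix.one_apply_ne hk]
  · simp

theorem posSemidef_sum_smul {d : ℕ} {ι : Type*} [Fintype ι] {q : ι → ℝ} {A : ι → Mat d}
    (hq : ∀ i, 0 ≤ q i) (hA : ∀ i, (A i).PosSemidef) : (∑ i, q i • A i).PosSemidef :=
  Matrix.posSemidef_sum _ fun i _ => (hA i).smul (hq i)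

theorem entropy_concave {d : ℕ} {ι : Type*} [Fintype ι] {q : ι → ℝ} {A : ι → Mat d}
    (hq : IsProb q) (hA : ∀ i, (A i).PosSemidef) :
    ∑ j, q j * entropy (A j) ≤ entropy (∑ j, q j • A j) := by
  have hS := posSemidef_sum_smul hq.1 hA
  rw [entropy_eq hS.1]
  simp_rw [fun j => entropy_eq (hA j).1, ← mul_div_assoc, ← Finset.sum_div]
  refine div_le_div_of_nonneg_right ?_ log_two_pos'.le
  have hW : ((hS.1.eigenvectorUnitary : Mat d))ᴴ * (hS.1.eigenvectorUnitary : Mat d) = 1 :=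
    Unitary.coe_star_mul_self hS.1.eigenvectorUnitary
  have hdiag := diag_self hS.1
  set W : Mat d := (hS.1.eigenvectorUnitary : Mat d) with hWdef
  calc ∑ j, q j * ∑ k, Real.negMulLog ((hA j).1.eigenvalues k)
      ≤ ∑ j, q j * ∑ i, Real.negMulLog (((Wᴴ * A j * W) i i).re) :=
        Finset.sum_le_sum fun j _ => mul_le_mul_of_nonneg_left (peierls (hA j) hW) (hq.1 j)
    _ = ∑ i, ∑ j, q j * Real.negMulLog (((Wᴴ * A j * W) i i).re) := by
        simp_rw [Finset.mul_sum]
        exact Finset.sum_comm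
    _ ≤ _ := by
        refine Finset.sum_le_sum fun i _ => ?_
        have := Real.concaveOn_negMulLog.le_map_sum (t := Finset.univ)
          (w := q) (p := fun j => ((Wᴴ * A j * W) i i).re)
          (fun j _ => hq.1 j) hq.2
          (fun j _ => by
            have := ((hA j).conjTranspose_mul_mul_same W).diag_nonneg (i := i)
            exact (Complex.le_def.1 this).1)
        simp only [smul_eq_mul] at this
        refine this.trans (le_of_eq ?_)
        rw [← hdiag i]
        congr 1
        simp [Matrix.mul_sum, Matrix.sum_mul, Matrix.sum_apply, Complex.re_sum]

theorem entropy_bounds {d : ℕ} {A : Mat d} (hA : IsDensityMatrix A) :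
    0 ≤ entropy A ∧ entropy A ≤ d / Real.log 2 := by
  have h0 := hA.1.eigenvalues_nonneg
  have hsum : ∑ i, hA.1.1.eigenvalues i = 1 := by
    have := hA.1.1.trace_eq_sum_eigenvalues
    have := congrArg Complex.re (hA.2.symm.trans this)
    simpa [Complex.re_sum] using this.symm
  have h1 : ∀ i, hA.1.1.eigenvalues i ≤ 1 := fun i => by
    rw [← hsum]
    exact Finset.single_le_sum (fun j _ => h0 j) (Finset.mem_univ i)
  rw [entropy_eq hA.1.1]
  refine ⟨div_nonneg (Finset.sum_nonneg fun i _ => Real.negMulLog_nonneg (h0 i) (h1 i))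
    log_two_pos'.le, div_le_div_of_nonneg_right ?_ log_two_pos'.le⟩
  calc _ ≤ ∑ i : Fin d, (1 : ℝ) := Finset.sum_le_sum fun i _ => by
        linarith [Real.negMulLog_le_one_sub_self (h0 i), h0 i]
    _ = d := by simp

theorem channel_density {d : ℕ} {N : Mat d → Mat d} (hN : IsChannel N) {ρ : Mat d}
    (hρ : IsDensityMatrix ρ) : IsDensityMatrix (N ρ) := by
  obtain ⟨n, L, hL, hN⟩ := hN
  rw [hN]
  refine ⟨Matrix.posSemidef_sum _ fun k _ => hρ.1.mul_mul_conjTranspose_same (L k), ?_⟩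
  rw [Matrix.trace_sum]
  simp_rw [fun k => Matrix.trace_mul_cycle (L k) ρ (L k)ᴴ]
  rw [← Matrix.trace_sum, ← Matrix.sum_mul, hL, Matrix.one_mul, hρ.2]

theorem density_mix {d : ℕ} {ι : Type*} [Fintype ι] {q : ι → ℝ} {A : ι → Mat d}
    (hq : IsProb q) (hA : ∀ i, IsDensityMatrix (A i)) : IsDensityMatrix (∑ j, q j • A j) := by
  refine ⟨posSemidef_sum_smul hq.1 fun i => (hA i).1, ?_⟩
  rw [Matrix.trace_sum]
  simp_rw [Matrix.trace_smul, fun i => (hA i).2]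
  have := congrArg (fun r : ℝ => (r : ℂ)) hq.2
  simpa using this

theorem holevo_le {d : ℕ} {ι : Type*} [Fintype ι] {q : ι → ℝ} {A : ι → Mat d}
    (hq : IsProb q) (hA : ∀ i, IsDensityMatrix (A i)) : holevo q A ≤ d / Real.log 2 := by
  have h1 := (entropy_bounds (density_mix hq hA)).2
  have h2 : 0 ≤ ∑ x, q x * entropy (A x) :=
    Finset.sum_nonneg fun x _ => mul_nonneg (hq.1 x) (entropy_bounds (hA x)).1
  unfold holevo
  linarith

theorem free_id {d : ℕ} (F : Set (Mat d)) : IsFreeChannel F (fun A => A) :=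
  ⟨⟨1, fun _ => 1, by simp, fun A => by simp⟩, fun _ h => h⟩

instance locallyConvex_mat (d : ℕ) : LocallyConvexSpace ℝ (Mat d) :=
  inferInstanceAs (LocallyConvexSpace ℝ (Fin d → Fin d → ℂ))

/-- Evaluation at `ρ` as a continuous affine map. -/
noncomputable def evalAff {d : ℕ} (ρ : Mat d) : (Mat d → Mat d) →ᴬ[ℝ] Mat d :=
  (ContinuousLinearMap.proj (R := ℝ) (φ := fun _ : Mat d => Mat d) ρ).toContinuousAffineMap

theorem evalAff_apply {d : ℕ} (ρ : Mat d) (N : Mat d → Mat d) : evalAff ρ N = N ρ := rfl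

theorem decompose {d : ℕ} {S : Set (Mat d → Mat d)} (hconv : Convex ℝ S) (hcomp : IsCompact S)
    (ρ : Mat d) {N : Mat d → Mat d} (hN : N ∈ S) :
    ∃ (ι : Type) (_ : Fintype ι) (w : ι → ℝ) (M : ι → Mat d → Mat d), IsProb w ∧
      (∀ i, M i ∈ Set.extremePoints ℝ S) ∧ ∑ i, w i • M i ρ = N ρ := by
  have hK : IsCompact (evalAff ρ '' S) := hcomp.image (evalAff ρ).continuous
  have hc : Convex ℝ (evalAff ρ '' S) := hconv.affine_image (evalAff ρ).toAffineMap
  have h := minkowski_hull hc hK _ _ (Set.mem_image_of_mem _ hN) rfl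
  obtain ⟨ι, hι, w, z, hw0, hw1, hz, hsum⟩ := mem_convexHull_iff_exists_fintype.1 h
  choose M hM hMz using fun i => surjOn_extremePoints_image (evalAff ρ) hcomp (hz i)
  refine ⟨ι, hι, w, M, ⟨hw0, hw1⟩, hM, ?_⟩
  simp_rw [← evalAff_apply ρ, hMz]
  exact hsum

/-- If the set of free channels (as a subset of the real vector space of
maps on `d × d` matrices) is convex and compact, then the free encoding capacity equals
the supremum of Holevo quantities over ensembles consisting only of extreme points of the
set of free channels. -/
theorem FEC_attained_on_extreme_points {d : ℕ} (F : Set (Mat d))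
    (hconv : Convex ℝ {N : Mat d → Mat d | IsFreeChannel F N})
    (hcomp : IsCompact {N : Mat d → Mat d | IsFreeChannel F N})
    (ρ : Mat d) (hρ : IsDensityMatrix ρ) :
    FEC F ρ =
      sSup {c : ℝ | ∃ (n : ℕ) (p : Fin n → ℝ) (N : Fin n → (Mat d → Mat d)),
        IsProb p ∧
        (∀ x, N x ∈ Set.extremePoints ℝ {M : Mat d → Mat d | IsFreeChannel F M}) ∧
        c = holevo p (fun x => N x ρ)} := by
  have hsub : Set.extremePoints ℝ {M : Mat d → Mat d | IsFreeChannel F M} ⊆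
      {M : Mat d → Mat d | IsFreeChannel F M} := extremePoints_subset
  have hbdd : BddAbove {c : ℝ | ∃ (n : ℕ) (p : Fin n → ℝ) (N : Fin n → (Mat d → Mat d)),
      IsProb p ∧ (∀ x, IsFreeChannel F (N x)) ∧ c = holevo p (fun x => N x ρ)} := by
    refine ⟨d / Real.log 2, ?_⟩
    rintro c ⟨n, p, N, hp, hN, rfl⟩
    exact holevo_le hp fun x => channel_density (hN x).1 hρ
  have hincl : {c : ℝ | ∃ (n : ℕ) (p : Fin n → ℝ) (N : Fin n → (Mat d → Mat d)),
        IsProb p ∧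
        (∀ x, N x ∈ Set.extremePoints ℝ {M : Mat d → Mat d | IsFreeChannel F M}) ∧
        c = holevo p (fun x => N x ρ)} ⊆
      {c : ℝ | ∃ (n : ℕ) (p : Fin n → ℝ) (N : Fin n → (Mat d → Mat d)),
      IsProb p ∧ (∀ x, IsFreeChannel F (N x)) ∧ c = holevo p (fun x => N x ρ)} := by
    rintro c ⟨n, p, N, hp, hN, rfl⟩
    exact ⟨n, p, N, hp, fun x => hsub (hN x), rfl⟩
  obtain ⟨M₀, hM₀⟩ := hcomp.extremePoints_nonempty ⟨_, free_id F⟩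
  have hone : IsProb (fun _ : Fin 1 => (1 : ℝ)) := ⟨fun _ => zero_le_one, by simp⟩
  rw [FEC]
  apply le_antisymm
  · refine csSup_le ⟨_, 1, fun _ => 1, fun _ => M₀, hone, fun _ => hsub hM₀, rfl⟩ ?_
    rintro c ⟨n, p, N, hp, hN, rfl⟩
    choose ι hι w M hw hM hMN using fun x => decompose hconv hcomp ρ (hN x)
    let e : Fin (Fintype.card (Σ x, ι x)) ≃ Σ x, ι x := (Fintype.equivFin _).symm
    let q : (Σ x, ι x) → ℝ := fun y => p y.1 * w y.1 y.2
    refine le_trans ?_ (le_csSup (hbdd.mono hincl) ⟨Fintype.card (Σ x, ι x),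
      fun k => q (e k), fun k => M (e k).1 (e k).2, ⟨fun k => ?_, ?_⟩, fun k => hM _ _, rfl⟩)
    · have h1 : ∑ k, q (e k) • M (e k).1 (e k).2 ρ = ∑ x, p x • N x ρ := by
        rw [e.sum_comp (fun y => q y • M y.1 y.2 ρ), Fintype.sum_sigma]
        refine Finset.sum_congr rfl fun x _ => ?_
        rw [← hMN x, Finset.smul_sum]
        exact Finset.sum_congr rfl fun j _ => mul_smul _ _ _
      have h2 : ∑ k, q (e k) * entropy (M (e k).1 (e k).2 ρ) ≤ ∑ x, p x * entropy (N x ρ) := by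
        rw [e.sum_comp (fun y => q y * entropy (M y.1 y.2 ρ)), Fintype.sum_sigma]
        refine Finset.sum_le_sum fun x _ => ?_
        simp only [q, mul_assoc]
        rw [← Finset.mul_sum, ← hMN x]
        exact mul_le_mul_of_nonneg_left
          (entropy_concave (hw x) fun j => (channel_density (hsub (hM x j)).1 hρ).1) (hp.1 x)
      unfold holevo
      rw [h1]
      linarith
    · exact mul_nonneg (hp.1 _) ((hw _).1 _)
    · rw [e.sum_comp q, Fintype.sum_sigma]
      simp only [q]
      simp_rw [← Finset.mul_sum, fun x => (hw x).2, mul_one]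
      exact hp.2
  · exact csSup_le_csSup hbdd ⟨_, 1, fun _ => 1, fun _ => M₀, hone, fun _ => hM₀, rfl⟩ hincl

end FECpaper
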